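/- Every g ∈ Sp_{2m}(ℤ) can be written g = i ω n with i ∈ I, ω ∈ 𝔚 and n ∈ N; moreover Sp_{2m}(ℤ) is the disjoint union over ω ∈ 𝔚 of the double cosets I ω I. -/

import Mathlib

open Matrix

/-- `J = [[0, I_m], [−I_m, 0]]`. -/
def Jmat (m : ℕ) (R : Type*) [CommRing R] :
    Matrix (Fin m ⊕ Fin m) (Fin m ⊕ Fin m) R :=
  Matrix.fromBlocks 0 1 (-1) 0

/-- `Sp_{2m}(R) = {A : A J Aᵀ = J}`. -/
def SpSet (m : ℕ) (R : Type*) [CommRing R] :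
    Set (Matrix (Fin m ⊕ Fin m) (Fin m ⊕ Fin m) R) :=
  {A | A * Jmat m R * Aᵀ = Jmat m R}

/-- The Weyl element `ω_s` of a permutation `s` of `{1,…,m}`: the matrix of the
map `e_i ↦ e_{s(i)}`, `e_i* ↦ e_{s(i)}*` (row vectors act on the right). -/
def permWeyl (m : ℕ) (R : Type*) [CommRing R] (s : Equiv.Perm (Fin m)) :
    Matrix (Fin m ⊕ Fin m) (Fin m ⊕ Fin m) R :=
  Matrix.of fun p q =>
    match p, q with
    | Sum.inl i, Sum.inl j => if s i = j then 1 else 0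
    | Sum.inr i, Sum.inr j => if s i = j then 1 else 0
    | _, _ => 0

/-- The Weyl element `ω_S` of a subset `S ⊆ {1,…,m}`: the matrix of the map
`e_i ↦ −e_i*`, `e_i* ↦ e_i` for `i ∈ S`, identity on the other basis vectors. -/
def signWeyl (m : ℕ) (R : Type*) [CommRing R] (S : Finset (Fin m)) :
    Matrix (Fin m ⊕ Fin m) (Fin m ⊕ Fin m) R :=
  Matrix.of fun p q =>
    match p, q with
    | Sum.inl i, Sum.inl j => if i ∉ S ∧ i = j then 1 else 0
    | Sum.inl i, Sum.inr j => if i ∈ S ∧ i = j then -1 else 0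
    | Sum.inr i, Sum.inl j => if i ∈ S ∧ i = j then 1 else 0
    | Sum.inr i, Sum.inr j => if i ∉ S ∧ i = j then 1 else 0

/-- `𝔚 = {ω_s ω_S}`, a set of representatives for the Weyl group. -/
def WeylSet (m : ℕ) (R : Type*) [CommRing R] :
    Set (Matrix (Fin m ⊕ Fin m) (Fin m ⊕ Fin m) R) :=
  {W | ∃ (s : Equiv.Perm (Fin m)) (S : Finset (Fin m)),
      W = permWeyl m R s * signWeyl m R S}

/-- `B(𝔽₂) = {[[α, αβ], [0, (αᵀ)⁻¹]]}` with `α` unipotent upper triangular and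
`β` symmetric, over `𝔽₂ = ZMod 2`. -/
def BOverF2 (m : ℕ) : Set (Matrix (Fin m ⊕ Fin m) (Fin m ⊕ Fin m) (ZMod 2)) :=
  {A | ∃ α β : Matrix (Fin m) (Fin m) (ZMod 2),
      (∀ i j : Fin m, j < i → α i j = 0) ∧ (∀ i, α i i = 1) ∧ βᵀ = β ∧
      A = Matrix.fromBlocks α (α * β) 0 (αᵀ)⁻¹}

/-- The Iwahori subgroup `I = red₂⁻¹(B(𝔽₂)) ⊆ Sp_{2m}(ℤ)` at the prime 2. -/
def IwahoriSet (m : ℕ) : Set (Matrix (Fin m ⊕ Fin m) (Fin m ⊕ Fin m) ℤ) :=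
  {A | A ∈ SpSet m ℤ ∧ A.map (Int.cast : ℤ → ZMod 2) ∈ BOverF2 m}

/-- `D₀ = {diag(d₁,…,d_m, d₁⁻¹,…,d_m⁻¹) : dᵢ ∈ ℤ_{>0}, d_m | d_{m−1} | ⋯ | d₁}`. -/
def D0Set (m : ℕ) : Set (Matrix (Fin m ⊕ Fin m) (Fin m ⊕ Fin m) ℚ) :=
  {A | ∃ d : Fin m → ℤ, (∀ i, 0 < d i) ∧ (∀ i j : Fin m, i ≤ j → d j ∣ d i) ∧
      A = Matrix.diagonal (Sum.elim (fun i => (d i : ℚ)) fun i => ((d i : ℚ))⁻¹)}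

/-- `N`: integral matrices `[[α, αβ], [0, (αᵀ)⁻¹]]` with `α` unipotent upper
triangular and `β` symmetric. -/
def NSet (m : ℕ) : Set (Matrix (Fin m ⊕ Fin m) (Fin m ⊕ Fin m) ℤ) :=
  {A | ∃ α β : Matrix (Fin m) (Fin m) ℤ,
      (∀ i j : Fin m, j < i → α i j = 0) ∧ (∀ i, α i i = 1) ∧ βᵀ = β ∧
      A = Matrix.fromBlocks α (α * β) 0 (αᵀ)⁻¹}

/-- `D = {ω⁻¹ d ω : d ∈ D₀, ω ∈ 𝔚}`. -/
def DSet (m : ℕ) : Set (Matrix (Fin m ⊕ Fin m) (Fin m ⊕ Fin m) ℚ) :=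
  {A | ∃ d ∈ D0Set m, ∃ w ∈ WeylSet m ℚ, A = w⁻¹ * d * w}

/-- Entrywise cast of an integral matrix to a rational one. -/
def castQ (m : ℕ) (A : Matrix (Fin m ⊕ Fin m) (Fin m ⊕ Fin m) ℤ) :
    Matrix (Fin m ⊕ Fin m) (Fin m ⊕ Fin m) ℚ :=
  A.map (Int.cast : ℤ → ℚ)


section Unitriangular

variable {n α R : Type*} [LinearOrder α] [CommRing R]

/-- `A` is unitriangular for the ordering of the indices by `r`. -/
def IsUnitriangular (r : n → α) (A : Matrix n n R) : Prop :=
  A.BlockTriangular r ∧ ∀ i, A i i = 1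

lemma IsUnitriangular.eq_one [DecidableEq n] {r : n → α} {A : Matrix n n (ZMod 2)}
    (hr : Function.Injective r) (hA : IsUnitriangular r A)
    (hA' : IsUnitriangular (OrderDual.toDual ∘ r) A) : A = 1 := by
  ext i j
  rcases lt_trichotomy (r i) (r j) with h | h | h
  · rw [hA'.1 h, one_apply_ne (fun e => h.ne (congrArg r e))]
  · obtain rfl := hr h
    rw [hA.2, one_apply_eq]
  · rw [hA.1 h, one_apply_ne (fun e => h.ne' (congrArg r e))]

variable [Fintype n] [DecidableEq n] {r : n → α}

lemma Matrix.BlockTriangular.det_of_injective {A : Matrix n n R} (hA : A.BlockTriangular r)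
    (hr : Function.Injective r) : A.det = ∏ i, A i i := by
  rw [hA.det, Finset.prod_image (fun i _ j _ h => hr h)]
  refine Finset.prod_congr rfl fun i _ => ?_
  let _ : Unique {j // r j = r i} := ⟨⟨⟨i, rfl⟩⟩, fun j => Subtype.ext (hr j.2)⟩
  rw [det_unique]
  rfl

lemma IsUnitriangular.det_eq_one {A : Matrix n n R} (hA : IsUnitriangular r A)
    (hr : Function.Injective r) : A.det = 1 := by
  rw [hA.1.det_of_injective hr]
  exact Finset.prod_eq_one fun i _ => hA.2 i

lemma ZMod.two_eq_one_of_ne_zero {a : ZMod 2} : a ≠ 0 → a = 1 := by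
  revert a; decide

/-- Over `𝔽₂`, invertible triangular matrices are unitriangular. -/
lemma Matrix.BlockTriangular.isUnitriangular {A : Matrix n n (ZMod 2)} (hA : A.BlockTriangular r)
    (hr : Function.Injective r) (h : IsUnit A.det) : IsUnitriangular r A := by
  refine ⟨hA, fun i => ZMod.two_eq_one_of_ne_zero fun h0 => h.ne_zero ?_⟩
  rw [hA.det_of_injective hr]
  exact Finset.prod_eq_zero (Finset.mem_univ i) h0

namespace IsUnitriangular

variable {A B C D : Matrix n n (ZMod 2)}

lemma isUnit_det (hA : IsUnitriangular r A) (hr : Function.Injective r) : IsUnit A.det := by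
  rw [hA.det_eq_one hr]; exact isUnit_one

lemma mul (hA : IsUnitriangular r A) (hB : IsUnitriangular r B)
    (hr : Function.Injective r) : IsUnitriangular r (A * B) :=
  (hA.1.mul hB.1).isUnitriangular hr (by
    rw [det_mul]; exact (hA.isUnit_det hr).mul (hB.isUnit_det hr))

lemma inv (hA : IsUnitriangular r A) (hr : Function.Injective r) :
    IsUnitriangular r A⁻¹ := by
  have := A.invertibleOfIsUnitDet (hA.isUnit_det hr)
  exact (blockTriangular_inv_of_blockTriangular hA.1).isUnitriangular hr
    (isUnit_nonsing_inv_det A (hA.isUnit_det hr))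

/-- Uniqueness of the factorization into an upper and a lower unitriangular matrix. -/
lemma eq_of_mul_eq_mul (hr : Function.Injective r) (hA : IsUnitriangular r A)
    (hB : IsUnitriangular r B) (hC : IsUnitriangular (OrderDual.toDual ∘ r) C)
    (hD : IsUnitriangular (OrderDual.toDual ∘ r) D) (h : A * C = B * D) : A = B := by
  have hr' : Function.Injective (OrderDual.toDual ∘ r) := OrderDual.toDual.injective.comp hr
  have e : B⁻¹ * A = D * C⁻¹ := by
    calc B⁻¹ * A = B⁻¹ * (A * C) * C⁻¹ := by
          rw [Matrix.mul_assoc, Matrix.mul_assoc,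
            mul_nonsing_inv _ (hC.isUnit_det hr'), Matrix.mul_one]
      _ = D * C⁻¹ := by
          rw [h, ← Matrix.mul_assoc, nonsing_inv_mul _ (hB.isUnit_det hr), Matrix.one_mul]
  have h1 : B⁻¹ * A = 1 := eq_one hr ((hB.inv hr).mul hA hr)
    (e ▸ hD.mul (hC.inv hr') hr')
  calc A = B * (B⁻¹ * A) := by
        rw [← Matrix.mul_assoc, mul_nonsing_inv _ (hB.isUnit_det hr), Matrix.one_mul]
    _ = B := by rw [h1, Matrix.mul_one]

end IsUnitriangular

end Unitriangular

section Bruhat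

variable {n : Type*} [Fintype n] {r : n → ℕ}

lemma Equiv.Perm.eq_one_of_forall_le (hr : Function.Injective r) (π : Equiv.Perm n)
    (h : ∀ i, r i ≤ r (π i)) : π = 1 := by
  have h1 : ∑ i, r i = ∑ i, r (π i) := (Equiv.sum_comp π r).symm
  rw [Finset.sum_eq_sum_iff_of_le fun i _ => h i] at h1
  exact Equiv.ext fun i => (hr (h1 i (Finset.mem_univ i))).symm

/-- Disjointness of the Bruhat cells of `GL_n(𝔽₂)`. -/
lemma IsUnitriangular.perm_eq [DecidableEq n] {A B C D : Matrix n n (ZMod 2)} (hr : Function.Injective r)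
    (hA : IsUnitriangular r A) (hB : IsUnitriangular r B) (hC : IsUnitriangular r C)
    (hD : IsUnitriangular r D) {σ τ : Equiv.Perm n}
    (h : A * σ.permMatrix (ZMod 2) * B = C * τ.permMatrix (ZMod 2) * D) : σ = τ := by
  have e : (C⁻¹ * A) * σ.permMatrix (ZMod 2) = τ.permMatrix (ZMod 2) * (D * B⁻¹) := by
    calc (C⁻¹ * A) * σ.permMatrix (ZMod 2)
        = C⁻¹ * (A * σ.permMatrix (ZMod 2) * B) * B⁻¹ := by
          simp only [Matrix.mul_assoc]
          rw [mul_nonsing_inv _ (hB.isUnit_det hr), Matrix.mul_one]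
      _ = (C⁻¹ * C) * (τ.permMatrix (ZMod 2) * (D * B⁻¹)) := by
          rw [h]; simp only [Matrix.mul_assoc]
      _ = _ := by rw [nonsing_inv_mul _ (hC.isUnit_det hr), Matrix.one_mul]
  have hCA := (hC.inv hr).mul hA hr
  have hDB := hD.mul (hB.inv hr) hr
  generalize C⁻¹ * A = X at e hCA
  generalize D * B⁻¹ = Y at e hDB
  rw [Equiv.Perm.permMatrix, Equiv.Perm.permMatrix, PEquiv.mul_toMatrix_toPEquiv,
    PEquiv.toMatrix_toPEquiv_mul] at e
  have h1 : σ⁻¹ * τ = 1 := by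
    refine Equiv.Perm.eq_one_of_forall_le hr _ fun i => ?_
    by_contra! hlt
    have := congrFun (congrFun e i) (τ i)
    simp only [submatrix_apply, id, hDB.2] at this
    exact one_ne_zero (this.symm.trans (hCA.1 hlt))
  exact inv_mul_eq_one.mp h1

/-- Lexicographic comparison of vectors over `𝔽₂`, with indices ordered by `r`. -/
def LexLT (r : n → ℕ) (v w : n → ZMod 2) : Prop :=
  ∃ p, v p = 0 ∧ w p = 1 ∧ ∀ j, r j < r p → v j = w j

lemma wellFounded_lexLT (hr : Function.Injective r) : WellFounded (LexLT r) := by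
  have : IsTrans (n → ZMod 2) (LexLT r) := ⟨by
    rintro u v w ⟨p, hp0, hp1, hp⟩ ⟨q, hq0, hq1, hq⟩
    rcases lt_trichotomy (r p) (r q) with h | h | h
    · exact ⟨p, hp0, (hq p h) ▸ hp1, fun j hj => (hp j hj).trans (hq j (hj.trans h))⟩
    · obtain rfl := hr h
      exact ⟨p, hp0, hq1, fun j hj => (hp j hj).trans (hq j hj)⟩
    · exact ⟨q, (hp q h).trans hq0, hq1, fun j hj => (hp j (hj.trans h)).trans (hq j hj)⟩⟩
  have : Std.Irrefl (LexLT r) := ⟨by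
    rintro v ⟨p, h0, h1, -⟩
    exact zero_ne_one (h0.symm.trans h1)⟩
  exact Finite.wellFounded_of_trans_of_irrefl _

lemma exists_leading_index {v : n → ZMod 2} (hv : v ≠ 0) :
    ∃ p, v p = 1 ∧ ∀ j, r j < r p → v j = 0 := by
  have hne : (Finset.univ.filter fun j => v j ≠ 0).Nonempty := by
    obtain ⟨j, hj⟩ := Function.ne_iff.mp hv
    exact ⟨j, by simpa using hj⟩
  obtain ⟨p, hp, hmin⟩ := Finset.exists_min_image _ r hne
  refine ⟨p, ZMod.two_eq_one_of_ne_zero (by simpa using hp), fun j hj => ?_⟩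
  by_contra h
  exact (hmin j (by simpa using h)).not_gt hj

/-- Bruhat decomposition of `GL_n(𝔽₂)`, in refined form. -/
lemma exists_bruhat [DecidableEq n] (hr : Function.Injective r) {A : Matrix n n (ZMod 2)}
    (hA : IsUnit A.det) :
    ∃ (U : Matrix n n (ZMod 2)) (τ : Equiv.Perm n), IsUnitriangular r U ∧
      IsUnitriangular (OrderDual.toDual ∘ r) ((U * A).submatrix id τ) ∧
      IsUnitriangular r ((U * A).submatrix τ.symm id) := by
  have hmin (i : n) : ∃ c : n → ZMod 2, (c i = 1 ∧ ∀ k, r k < r i → c k = 0) ∧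
      ∀ d : n → ZMod 2, d i = 1 → (∀ k, r k < r i → d k = 0) →
        ¬ LexLT r (d ᵥ* A) (c ᵥ* A) := by
    obtain ⟨c, hc, h⟩ := (InvImage.wf (· ᵥ* A) (wellFounded_lexLT hr)).has_min
      {c : n → ZMod 2 | c i = 1 ∧ ∀ k, r k < r i → c k = 0}
      ⟨Pi.single i 1, Pi.single_eq_same _ _,
        fun k hk => Pi.single_eq_of_ne (fun e => hk.ne (congrArg r e)) _⟩
    exact ⟨c, hc, fun d h1 h2 => h d ⟨h1, h2⟩⟩
  choose U hU hUmin using hmin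
  have hUtri : IsUnitriangular r (of U) := ⟨fun i j h => (hU i).2 j h, fun i => (hU i).1⟩
  have hM (i : n) : (of U * A) i = U i ᵥ* A := rfl
  have hdet : IsUnit (of U * A).det := by
    rw [det_mul]; exact (hUtri.isUnit_det hr).mul hA
  have hne (i : n) : (of U * A) i ≠ 0 := fun h =>
    hdet.ne_zero (det_eq_zero_of_row_eq_zero i fun j => congrFun h j)
  choose t ht1 ht0 using fun i => exists_leading_index (r := r) (hne i)
  have hzero {i k : n} (hik : r i < r k) : (of U * A) i (t k) = 0 := by
    by_contra hcon
    have h1 := ZMod.two_eq_one_of_ne_zero hcon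
    refine hUmin i (U i + U k) ?_ ?_ ?_
    · simp [(hU i).1, (hU k).2 i hik]
    · intro j hj
      simp [(hU i).2 j hj, (hU k).2 j (hj.trans hik)]
    · rw [add_vecMul, ← hM, ← hM]
      refine ⟨t k, ?_, h1, fun j hj => ?_⟩
      · rw [Pi.add_apply, h1, ht1]; rfl
      · rw [Pi.add_apply, ht0 k j hj, add_zero]
  have hinj : Function.Injective t := by
    intro i k h
    by_contra hik
    rcases lt_or_gt_of_ne (hr.ne hik) with hlt | hlt
    · exact one_ne_zero ((ht1 i).symm.trans (h ▸ hzero hlt))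
    · exact one_ne_zero ((ht1 k).symm.trans (h ▸ hzero hlt))
  refine ⟨of U, Equiv.ofBijective t (Finite.injective_iff_bijective.mp hinj), hUtri,
    ⟨fun i k h => hzero h, ht1⟩, ?_⟩
  generalize hτ : Equiv.ofBijective t _ = τ
  have hτ' (i : n) : t i = τ i := by rw [← hτ]; rfl
  refine ⟨fun i j h => ht0 _ j ?_, fun i => ?_⟩
  · rwa [hτ', Equiv.apply_symm_apply]
  · have := ht1 (τ.symm i)
    rwa [hτ', Equiv.apply_symm_apply] at this

end Bruhat

section Symplectic

variable {l : Type*} [Fintype l] [DecidableEq l]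

/-- The exchange of `e_i` and `e_i*`, as a permutation. -/
abbrev swapPerm (l : Type*) : Equiv.Perm (l ⊕ l) := Equiv.sumComm l l

lemma J_eq_permMatrix (l : Type*) [DecidableEq l] :
    J l (ZMod 2) = (swapPerm l).permMatrix (ZMod 2) := by
  ext i j
  rcases i with i | i <;> rcases j with j | j <;>
    simp [J, PEquiv.toMatrix_apply, one_apply]

/-- The transposed inverse of `A`, with indices exchanged by `Sum.swap`; over `𝔽₂` the symplectic
matrices are its fixed points. -/
noncomputable def swapDual (A : Matrix (l ⊕ l) (l ⊕ l) (ZMod 2)) :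
    Matrix (l ⊕ l) (l ⊕ l) (ZMod 2) :=
  (A⁻¹)ᵀ.submatrix (swapPerm l) (swapPerm l)

variable {A B : Matrix (l ⊕ l) (l ⊕ l) (ZMod 2)}

lemma swapDual_mul : swapDual (A * B) = swapDual A * swapDual B := by
  rw [swapDual, Matrix.mul_inv_rev, transpose_mul, ← submatrix_mul_equiv _ _ _ (swapPerm l)]
  rfl

lemma swapDual_permMatrix (τ : Equiv.Perm (l ⊕ l)) :
    swapDual (τ.permMatrix (ZMod 2)) =
      (swapPerm l * τ * swapPerm l).permMatrix (ZMod 2) := by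
  have h : (τ.permMatrix (ZMod 2))⁻¹ = (τ⁻¹).permMatrix (ZMod 2) := by
    refine inv_eq_left_inv ?_
    rw [← permMatrix_mul, mul_inv_cancel, permMatrix_one]
  rw [swapDual, h, transpose_permMatrix, inv_inv]
  ext i j
  simp only [submatrix_apply, Equiv.Perm.permMatrix, PEquiv.toMatrix_apply, Equiv.toPEquiv_apply,
    Option.mem_some_iff]
  congr 1
  exact propext (Equiv.eq_symm_apply (swapPerm l))

lemma mem_symplecticGroup_iff_swapDual (h : IsUnit A.det) :
    A ∈ symplecticGroup l (ZMod 2) ↔ swapDual A = A := by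
  have hT : IsUnit Aᵀ.det := by rwa [det_transpose]
  have e : A ∈ symplecticGroup l (ZMod 2) ↔ A * J l (ZMod 2) = J l (ZMod 2) * (Aᵀ)⁻¹ := by
    rw [SymplecticGroup.mem_iff]
    constructor
    · intro h
      rw [← h, Matrix.mul_assoc _ Aᵀ, mul_nonsing_inv _ hT, Matrix.mul_one, h]
    · intro h
      rw [h, Matrix.mul_assoc, nonsing_inv_mul _ hT, Matrix.mul_one]
  rw [e, J_eq_permMatrix, Equiv.Perm.permMatrix, PEquiv.mul_toMatrix_toPEquiv,
    PEquiv.toMatrix_toPEquiv_mul, ← transpose_nonsing_inv]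
  constructor
  · intro h
    ext i j
    have := congrFun (congrFun h i) j.swap
    simpa [swapDual] using this.symm
  · intro h
    ext i j
    have := congrFun (congrFun h i) j.swap
    simpa [swapDual] using this.symm

lemma isUnit_det_permMatrix {n : Type*} [Fintype n] [DecidableEq n] (τ : Equiv.Perm n) :
    IsUnit (τ.permMatrix (ZMod 2)).det := by
  rw [Equiv.Perm.permMatrix, det_permutation]
  exact (Units.isUnit _).map (Int.castRingHom _)

lemma permMatrix_mem_symplecticGroup {τ : Equiv.Perm (l ⊕ l)}
    (h : swapPerm l * τ * swapPerm l = τ) :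
    τ.permMatrix (ZMod 2) ∈ symplecticGroup l (ZMod 2) := by
  rw [mem_symplecticGroup_iff_swapDual (isUnit_det_permMatrix τ), swapDual_permMatrix, h]

variable {r : l ⊕ l → ℕ}

lemma isUnitriangular_swapDual (hr : Function.Injective r)
    (hs : ∀ i j, r i < r j → r j.swap < r i.swap) (hA : IsUnitriangular r A) :
    IsUnitriangular r (swapDual A) :=
  ⟨fun i j h => (hA.inv hr).1 (hs j i h), fun _ => (hA.inv hr).2 _⟩

lemma isUnitriangular_swapDual_toDual (hr : Function.Injective r)
    (hs : ∀ i j, r i < r j → r j.swap < r i.swap)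
    (hA : IsUnitriangular (OrderDual.toDual ∘ r) A) :
    IsUnitriangular (OrderDual.toDual ∘ r) (swapDual A) :=
  ⟨fun i j h => (hA.inv (OrderDual.toDual.injective.comp hr)).1 (hs i j h),
    fun _ => (hA.inv (OrderDual.toDual.injective.comp hr)).2 _⟩

lemma inv_mem_symplecticGroup {R : Type*} [CommRing R] {A : Matrix (l ⊕ l) (l ⊕ l) R}
    (h : A ∈ symplecticGroup l R) : A⁻¹ ∈ symplecticGroup l R := by
  have := (⟨A, h⟩ : symplecticGroup l R)⁻¹.2
  rwa [SymplecticGroup.coe_inv'] at this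

/-- Bruhat decomposition of `Sp_{2m}(𝔽₂)`. -/
lemma exists_symplectic_bruhat (hr : Function.Injective r)
    (hs : ∀ i j, r i < r j → r j.swap < r i.swap) (hA : A ∈ symplecticGroup l (ZMod 2)) :
    ∃ B C : Matrix (l ⊕ l) (l ⊕ l) (ZMod 2), ∃ τ : Equiv.Perm (l ⊕ l),
      IsUnitriangular r B ∧ B ∈ symplecticGroup l (ZMod 2) ∧
      IsUnitriangular r C ∧ C ∈ symplecticGroup l (ZMod 2) ∧
      swapPerm l * τ * swapPerm l = τ ∧
      A = B * τ.permMatrix (ZMod 2) * C := by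
  have hAdet := SymplecticGroup.symplectic_det hA
  obtain ⟨U, τ, hU, hL, hC⟩ := exists_bruhat hr hAdet
  have hUdet := hU.isUnit_det hr
  set L := (U * A).submatrix id τ with hLdef
  set C := (U * A).submatrix τ.symm id with hCdef
  have eC : U * A = τ.permMatrix (ZMod 2) * C := by
    rw [Equiv.Perm.permMatrix, PEquiv.toMatrix_toPEquiv_mul, hCdef]
    ext i j; simp
  have eL : U * A = L * τ.permMatrix (ZMod 2) := by
    rw [Equiv.Perm.permMatrix, PEquiv.mul_toMatrix_toPEquiv, hLdef]
    ext i j; simp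
  have hfix : swapDual A = A := (mem_symplecticGroup_iff_swapDual hAdet).mp hA
  have hU' := isUnitriangular_swapDual hr hs hU
  have cancel {V X : Matrix (l ⊕ l) (l ⊕ l) (ZMod 2)} (hV : IsUnit V.det) (h : V * A = X) :
      A = V⁻¹ * X := by
    rw [← h, ← Matrix.mul_assoc, nonsing_inv_mul _ hV, Matrix.one_mul]
  have hτ : swapPerm l * τ * swapPerm l = τ := by
    have e1 := cancel hUdet eC
    have e2 := congrArg swapDual eC
    rw [swapDual_mul, swapDual_mul, hfix, swapDual_permMatrix] at e2
    have e3 := cancel (hU'.isUnit_det hr) e2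
    rw [← Matrix.mul_assoc] at e1 e3
    exact IsUnitriangular.perm_eq hr (hU'.inv hr) (isUnitriangular_swapDual hr hs hC) (hU.inv hr) hC
      (e3.symm.trans e1)
  have hUmem : U ∈ symplecticGroup l (ZMod 2) := by
    rw [mem_symplecticGroup_iff_swapDual hUdet]
    have e1 := cancel hUdet eL
    have e2 := congrArg swapDual eL
    rw [swapDual_mul, swapDual_mul, hfix, swapDual_permMatrix, hτ] at e2
    have e3 := cancel (hU'.isUnit_det hr) e2
    have e4 : U⁻¹ * L = (swapDual U)⁻¹ * swapDual L := by
      rw [← Matrix.mul_assoc] at e1 e3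
      exact mul_left_injective_of_inv _ _ (mul_nonsing_inv _ (isUnit_det_permMatrix τ))
        (e1.symm.trans e3)
    have e5 := IsUnitriangular.eq_of_mul_eq_mul hr (hU.inv hr) (hU'.inv hr) hL
      (isUnitriangular_swapDual_toDual hr hs hL) e4
    exact (inv_inj e5 hUdet).symm
  have hP := permMatrix_mem_symplecticGroup hτ
  refine ⟨U⁻¹, C, τ, hU.inv hr, inv_mem_symplecticGroup hUmem, hC, ?_, hτ, ?_⟩
  · have : C = (τ.permMatrix (ZMod 2))⁻¹ * (U * A) := by
      rw [eC, ← Matrix.mul_assoc, nonsing_inv_mul _ (SymplecticGroup.symplectic_det hP),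
        Matrix.one_mul]
    rw [this]
    exact mul_mem (inv_mem_symplecticGroup hP) (mul_mem hUmem hA)
  · rw [Matrix.mul_assoc]
    exact cancel hUdet eC

end Symplectic

section Integral

variable {m : ℕ}

lemma mem_SpSet_iff {R : Type*} [CommRing R] {A : Matrix (Fin m ⊕ Fin m) (Fin m ⊕ Fin m) R} :
    A ∈ SpSet m R ↔ A ∈ symplecticGroup (Fin m) R := by
  have hJ : Jmat m R = -J (Fin m) R := by
    simp [Jmat, J, fromBlocks_neg]
  rw [SymplecticGroup.mem_iff, SpSet, Set.mem_ofPred_eq, hJ, Matrix.mul_neg, Matrix.neg_mul,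
    neg_inj]

/-- Position of an index in the order `e_1, …, e_m, e_m*, …, e_1*`. -/
def indexRank (m : ℕ) : Fin m ⊕ Fin m → ℕ :=
  Sum.elim (fun i => i) (fun i => 2 * m - i)

lemma indexRank_injective : Function.Injective (indexRank m) := by
  rintro (i | i) (j | j) h <;> simp only [indexRank, Sum.elim_inl, Sum.elim_inr] at h
  · rw [Fin.ext h]
  · omega
  · omega
  · rw [Fin.ext (by omega : (i : ℕ) = j)]

lemma indexRank_swap (i j : Fin m ⊕ Fin m) (h : indexRank m i < indexRank m j) :
    indexRank m j.swap < indexRank m i.swap := by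
  rcases i with i | i <;> rcases j with j | j <;>
    simp only [indexRank, Sum.elim_inl, Sum.elim_inr, Sum.swap_inl, Sum.swap_inr] at h ⊢ <;> omega

/-- The block matrix of `BOverF2` and `NSet` is symplectic. -/
lemma fromBlocks_mem_symplecticGroup {R : Type*} [CommRing R] {α β : Matrix (Fin m) (Fin m) R}
    (hα : IsUnit α.det) (hβ : βᵀ = β) :
    fromBlocks α (α * β) 0 (αᵀ)⁻¹ ∈ symplecticGroup (Fin m) R := by
  have hαT : IsUnit αᵀ.det := by rwa [det_transpose]
  rw [SymplecticGroup.fromBlocks_mem_iff]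
  refine ⟨by simp, ?_, by simp [mul_nonsing_inv _ hαT]⟩
  rw [transpose_mul, hβ, Matrix.mul_assoc, mul_nonsing_inv _ hαT, transpose_nonsing_inv,
    transpose_transpose, ← Matrix.mul_assoc, nonsing_inv_mul _ hα, Matrix.mul_one, Matrix.one_mul]

lemma isUnitriangular_of_mem_BOverF2 {A : Matrix (Fin m ⊕ Fin m) (Fin m ⊕ Fin m) (ZMod 2)}
    (hA : A ∈ BOverF2 m) : IsUnitriangular (indexRank m) A := by
  obtain ⟨α, β, h0, h1, -, rfl⟩ := hA
  have hα : IsUnitriangular id α := ⟨fun i j h => h0 i j h, h1⟩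
  have hα' := hα.inv Function.injective_id
  rw [← transpose_nonsing_inv]
  constructor
  · rintro (i | i) (j | j) h <;> simp only [indexRank, Sum.elim_inl, Sum.elim_inr] at h
    · exact h0 i j (Fin.lt_def.mpr h)
    · omega
    · rfl
    · exact hα'.1 (Fin.lt_def.mpr (by omega) : i < j)
  · rintro (i | i)
    · exact h1 i
    · exact hα'.2 i

lemma mem_BOverF2 {A : Matrix (Fin m ⊕ Fin m) (Fin m ⊕ Fin m) (ZMod 2)}
    (hA : IsUnitriangular (indexRank m) A) (hA' : A ∈ symplecticGroup (Fin m) (ZMod 2)) :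
    A ∈ BOverF2 m := by
  have hc : A.toBlocks₂₁ = 0 := by
    ext i j
    exact hA.1 (by simp only [indexRank, Sum.elim_inl, Sum.elim_inr]; omega)
  rw [← fromBlocks_toBlocks A, SymplecticGroup.fromBlocks_mem_iff, hc] at hA'
  obtain ⟨-, h1, h2⟩ := hA'
  rw [transpose_zero, Matrix.zero_mul, sub_zero] at h2
  have h3 : A.toBlocks₁₁ * A.toBlocks₂₂ᵀ = 1 := by
    rw [mul_eq_one_comm, ← transpose_one, ← h2, transpose_mul, transpose_transpose]
  refine ⟨A.toBlocks₁₁, A.toBlocks₂₂ᵀ * A.toBlocks₁₂, fun i j h => hA.1 h, fun i => hA.2 _, ?_, ?_⟩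
  · rw [transpose_mul, transpose_transpose, h1]
  · rw [← Matrix.mul_assoc, h3, Matrix.one_mul, inv_eq_right_inv h2, ← hc, fromBlocks_toBlocks]

lemma det_eq_one_of_unipotent {R : Type*} [CommRing R] {α : Matrix (Fin m) (Fin m) R}
    (h0 : ∀ i j : Fin m, j < i → α i j = 0) (h1 : ∀ i, α i i = 1) : α.det = 1 :=
  IsUnitriangular.det_eq_one (r := id) ⟨fun i j h => h0 i j h, h1⟩ Function.injective_id

lemma map_fromBlocks_inv {α β : Matrix (Fin m) (Fin m) ℤ} (hα : α.det = 1) :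
    (fromBlocks α (α * β) 0 (αᵀ)⁻¹).map (Int.castRingHom (ZMod 2)) =
      fromBlocks (α.map (Int.castRingHom (ZMod 2)))
        (α.map (Int.castRingHom (ZMod 2)) * β.map (Int.castRingHom (ZMod 2))) 0
        ((α.map (Int.castRingHom (ZMod 2)))ᵀ)⁻¹ := by
  have hαT : IsUnit αᵀ.det := by rw [det_transpose, hα]; exact isUnit_one
  rw [fromBlocks_map, Matrix.map_mul, Matrix.map_zero _ (map_zero _)]
  congr 1
  refine (inv_eq_right_inv ?_).symm
  rw [← transpose_map, ← Matrix.map_mul, mul_nonsing_inv _ hαT,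
    Matrix.map_one _ (map_zero _) (map_one _)]

lemma NSet_subset_IwahoriSet : NSet m ⊆ IwahoriSet m := by
  rintro _ ⟨α, β, h0, h1, hβ, rfl⟩
  have hα := det_eq_one_of_unipotent h0 h1
  refine ⟨mem_SpSet_iff.mpr (fromBlocks_mem_symplecticGroup (hα ▸ isUnit_one) hβ),
    α.map (Int.castRingHom (ZMod 2)), β.map (Int.castRingHom (ZMod 2)), fun i j h => ?_,
    fun i => ?_, ?_, map_fromBlocks_inv hα⟩
  · rw [map_apply, h0 i j h, map_zero]
  · rw [map_apply, h1, map_one]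
  · rw [← transpose_map, hβ]

lemma exists_NSet_lift {B : Matrix (Fin m ⊕ Fin m) (Fin m ⊕ Fin m) (ZMod 2)}
    (hB : B ∈ BOverF2 m) : ∃ n ∈ NSet m, n.map (Int.castRingHom (ZMod 2)) = B := by
  obtain ⟨α, β, h0, h1, hβ, rfl⟩ := hB
  have lift (X : Matrix (Fin m) (Fin m) (ZMod 2)) :
      (X.map fun x => (x.val : ℤ)).map (Int.castRingHom (ZMod 2)) = X := by
    ext i j; simp
  have h0' (i j : Fin m) (h : j < i) : (α.map fun x => (x.val : ℤ)) i j = 0 := by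
    rw [map_apply, h0 i j h]; rfl
  have h1' (i : Fin m) : (α.map fun x => (x.val : ℤ)) i i = 1 := by
    rw [map_apply, h1 i]; rfl
  refine ⟨_, ⟨α.map fun x => (x.val : ℤ), β.map fun x => (x.val : ℤ), h0', h1',
    by rw [← transpose_map, hβ], rfl⟩, ?_⟩
  rw [map_fromBlocks_inv (det_eq_one_of_unipotent h0' h1'), lift, lift]

/-- The permutation of the basis vectors underlying `ω_S`. -/
def signPerm (S : Finset (Fin m)) : Equiv.Perm (Fin m ⊕ Fin m) :=
  Function.Involutive.toPerm (fun p => if p.elim id id ∈ S then p.swap else p) (by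
    rintro (i | i) <;> by_cases h : i ∈ S <;> simp [h])

lemma signPerm_apply (S : Finset (Fin m)) (p : Fin m ⊕ Fin m) :
    signPerm S p = if p.elim id id ∈ S then p.swap else p := rfl

/-- The permutation of the basis vectors underlying `ω_s ω_S`. -/
def weylPerm (s : Equiv.Perm (Fin m)) (S : Finset (Fin m)) : Equiv.Perm (Fin m ⊕ Fin m) :=
  signPerm S * Equiv.sumCongr s s

lemma weylPerm_apply (s : Equiv.Perm (Fin m)) (S : Finset (Fin m)) (p : Fin m ⊕ Fin m) :
    weylPerm s S p = if s (p.elim id id) ∈ S then (p.map s s).swap else p.map s s := by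
  rcases p with i | i <;> rfl

lemma map_weyl (s : Equiv.Perm (Fin m)) (S : Finset (Fin m)) :
    (permWeyl m ℤ s * signWeyl m ℤ S).map (Int.castRingHom (ZMod 2)) =
      (weylPerm s S).permMatrix (ZMod 2) := by
  rw [Matrix.map_mul, weylPerm, permMatrix_mul]
  congr 1
  · ext (i | i) (j | j) <;> simp [permWeyl, PEquiv.toMatrix_apply]
  · have h2 : (-1 : ZMod 2) = 1 := rfl
    ext (i | i) (j | j) <;> by_cases h : i ∈ S <;> rcases eq_or_ne i j with rfl | hij <;>
      simp [signWeyl, signPerm_apply, PEquiv.toMatrix_apply, *]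

lemma weyl_mem_symplecticGroup (s : Equiv.Perm (Fin m)) (S : Finset (Fin m)) :
    permWeyl m ℤ s * signWeyl m ℤ S ∈ symplecticGroup (Fin m) ℤ := by
  refine mul_mem ?_ ?_
  · have : permWeyl m ℤ s = fromBlocks (s.permMatrix ℤ) 0 0 (s.permMatrix ℤ) := by
      ext (i | i) (j | j) <;> simp [permWeyl, PEquiv.toMatrix_apply]
    rw [this, SymplecticGroup.fromBlocks_mem_iff, transpose_permMatrix, ← permMatrix_mul]
    simp
  · have : signWeyl m ℤ S = fromBlocks (diagonal fun i => if i ∈ S then 0 else 1)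
        (diagonal fun i => if i ∈ S then -1 else 0) (diagonal fun i => if i ∈ S then 1 else 0)
        (diagonal fun i => if i ∈ S then 0 else 1) := by
      ext (i | i) (j | j) <;> by_cases h : i ∈ S <;> by_cases hij : i = j <;>
        simp [signWeyl, h, hij]
    rw [this, SymplecticGroup.fromBlocks_mem_iff]
    simp only [diagonal_transpose, diagonal_mul_diagonal, diagonal_sub]
    refine ⟨?_, ?_, ?_⟩
    · simp [mul_comm]
    · simp [mul_comm]
    · rw [← diagonal_one]
      congr 1
      ext i
      by_cases h : i ∈ S <;> simp [h]

lemma weylPerm_injective {s s' : Equiv.Perm (Fin m)} {S S' : Finset (Fin m)}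
    (h : weylPerm s S = weylPerm s' S') : s = s' ∧ S = S' := by
  have key (i : Fin m) : s i = s' i ∧ (s i ∈ S ↔ s' i ∈ S') := by
    have := Equiv.congr_fun h (Sum.inl i)
    rw [weylPerm_apply, weylPerm_apply] at this
    by_cases h1 : s i ∈ S <;> by_cases h2 : s' i ∈ S' <;> simp_all
  have hs : s = s' := Equiv.ext fun i => (key i).1
  subst hs
  refine ⟨rfl, Finset.ext fun j => ?_⟩
  simpa using (key (s.symm j)).2

lemma exists_eq_weylPerm {τ : Equiv.Perm (Fin m ⊕ Fin m)}
    (h : swapPerm (Fin m) * τ * swapPerm (Fin m) = τ) : ∃ s S, τ = weylPerm s S := by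
  have hswap (p : Fin m ⊕ Fin m) : τ p.swap = (τ p).swap := by
    have := Equiv.congr_fun h p.swap
    simpa using this.symm
  have hinj : Function.Injective fun i => (τ (Sum.inl i)).elim id id := by
    intro i j hij
    have h2 : τ (Sum.inl i) = τ (Sum.inl j) ∨ τ (Sum.inl i) = (τ (Sum.inl j)).swap := by
      revert hij
      dsimp only
      rcases τ (Sum.inl i) with a | a <;> rcases τ (Sum.inl j) with b | b <;> simp
    rcases h2 with h2 | h2
    · exact Sum.inl_injective (τ.injective h2)
    · rw [← hswap] at h2
      exact absurd (τ.injective h2) (by simp)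
  let s : Equiv.Perm (Fin m) := Equiv.ofBijective _ (Finite.injective_iff_bijective.mp hinj)
  have hs (i : Fin m) : s i = (τ (Sum.inl i)).elim id id := rfl
  refine ⟨s, Finset.univ.filter fun k => (τ (Sum.inl (s.symm k))).isRight, Equiv.ext fun p => ?_⟩
  have hl (i : Fin m) : τ (Sum.inl i) =
      if (τ (Sum.inl i)).isRight then Sum.inr (s i) else Sum.inl (s i) := by
    rw [hs]
    rcases τ (Sum.inl i) with a | a <;> simp
  rw [weylPerm_apply]
  rcases p with i | i
  · rw [hl i]; simp
  · have h3 := hswap (Sum.inl i)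
    rw [Sum.swap_inl] at h3
    rw [h3, hl i]
    by_cases h4 : (τ (Sum.inl i)).isRight <;> simp [h4]

end Integral

/-- Every `g ∈ Sp_{2m}(ℤ)` can be written `g = i ω n` with `i ∈ I`, `ω ∈ 𝔚`,
`n ∈ N`; moreover `Sp_{2m}(ℤ)` is the disjoint union over `ω ∈ 𝔚` of the
double cosets `I ω I`. -/
theorem stmt_1 (m : ℕ) (hm : 1 ≤ m) :
    (∀ g ∈ SpSet m ℤ, ∃ i ∈ IwahoriSet m, ∃ w ∈ WeylSet m ℤ, ∃ n ∈ NSet m,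
        g = i * w * n) ∧
    (∀ g ∈ SpSet m ℤ, ∃ w ∈ WeylSet m ℤ, ∃ i₁ ∈ IwahoriSet m, ∃ i₂ ∈ IwahoriSet m,
        g = i₁ * w * i₂) ∧
    (∀ w ∈ WeylSet m ℤ, ∀ w' ∈ WeylSet m ℤ,
      ∀ i₁ ∈ IwahoriSet m, ∀ i₂ ∈ IwahoriSet m, ∀ i₁' ∈ IwahoriSet m, ∀ i₂' ∈ IwahoriSet m,
        i₁ * w * i₂ = i₁' * w' * i₂' → w = w') := by
  have decomp : ∀ g ∈ SpSet m ℤ, ∃ i ∈ IwahoriSet m, ∃ w ∈ WeylSet m ℤ, ∃ n ∈ NSet m,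
      g = i * w * n := by
    intro g hg
    rw [mem_SpSet_iff] at hg
    obtain ⟨B, C, τ, hB, hB', hC, hC', hτ, hBC⟩ := exists_symplectic_bruhat
      indexRank_injective indexRank_swap (SymplecticGroup.map_mem hg (Int.castRingHom (ZMod 2)))
    obtain ⟨s, S, rfl⟩ := exists_eq_weylPerm hτ
    obtain ⟨n, hn, rfl⟩ := exists_NSet_lift (mem_BOverF2 hC hC')
    have hw := weyl_mem_symplecticGroup s S
    have hmap := map_weyl s S
    have hW : permWeyl m ℤ s * signWeyl m ℤ S ∈ WeylSet m ℤ := ⟨s, S, rfl⟩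
    generalize permWeyl m ℤ s * signWeyl m ℤ S = w at hw hmap hW
    have hwn : w * n ∈ symplecticGroup (Fin m) ℤ :=
      mul_mem hw (mem_SpSet_iff.mp (NSet_subset_IwahoriSet hn).1)
    have hwn' := SymplecticGroup.symplectic_det hwn
    have hg' : g = g * (w * n)⁻¹ * (w * n) := by
      rw [Matrix.mul_assoc, nonsing_inv_mul _ hwn', Matrix.mul_one]
    refine ⟨g * (w * n)⁻¹, ⟨mem_SpSet_iff.mpr (mul_mem hg (inv_mem_symplecticGroup hwn)), ?_⟩,
      w, hW, n, hn, by rwa [← Matrix.mul_assoc] at hg'⟩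
    have hred : (g * (w * n)⁻¹).map (Int.castRingHom (ZMod 2)) = B := by
      rw [hg', Matrix.map_mul, Matrix.mul_assoc, ← hmap,
        ← Matrix.map_mul (L := w)] at hBC
      have hdet := SymplecticGroup.symplectic_det
        (SymplecticGroup.map_mem hwn (Int.castRingHom (ZMod 2)))
      exact mul_left_injective_of_inv _ _ (mul_nonsing_inv _ hdet) hBC
    exact hred ▸ mem_BOverF2 hB hB'
  refine ⟨decomp, fun g hg => ?_, ?_⟩
  · obtain ⟨i, hi, w, hw, n, hn, h⟩ := decomp g hg
    exact ⟨w, hw, i, hi, n, NSet_subset_IwahoriSet hn, h⟩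
  · rintro _ ⟨s, S, rfl⟩ _ ⟨s', S', rfl⟩ i₁ h₁ i₂ h₂ i₁' h₁' i₂' h₂' h
    have e := congrArg (fun X => X.map (Int.castRingHom (ZMod 2))) h
    have hmul (X Y Z : Matrix (Fin m ⊕ Fin m) (Fin m ⊕ Fin m) ℤ) :
        (X * Y * Z).map (Int.castRingHom (ZMod 2)) = X.map (Int.castRingHom (ZMod 2)) *
          Y.map (Int.castRingHom (ZMod 2)) * Z.map (Int.castRingHom (ZMod 2)) := by
      rw [Matrix.map_mul, Matrix.map_mul]
    rw [hmul, hmul, map_weyl, map_weyl] at e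
    have := IsUnitriangular.perm_eq indexRank_injective
      (isUnitriangular_of_mem_BOverF2 h₁.2) (isUnitriangular_of_mem_BOverF2 h₂.2)
      (isUnitriangular_of_mem_BOverF2 h₁'.2) (isUnitriangular_of_mem_BOverF2 h₂'.2) e
    obtain ⟨rfl, rfl⟩ := weylPerm_injective this
    rfl
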